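/- arXiv:2603.22714 — 4 statements merged into one kernel-verified Lean document; each statement's English description precedes it below -/
import Mathlib

section
/- It holds that Σ_{x,z,b,r,ỹ} π³(b,r,x,z) · y(ỹ) · p(x,z,b,r,ỹ) = ψ, where π³(b,r,x,z) = (P(x₀|r,z)/P(x|r,z)) · (1[x = x₁]/P(x₀|z)) and ψ = Σ_{b,r,z} m(x₁,b,r,z) · P(b|x₁,r,z) · P(r|x₀,z) · P(z). That is, the inverse-probability-weighted mean of the outcome equals the identified path-specific functional ψ. -/
open Finset

noncomputable section

variable {𝒳 𝒵 ℬ ℛ 𝒴 : Type*}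
  [Fintype 𝒳] [Fintype 𝒵] [Fintype ℬ] [Fintype ℛ] [Fintype 𝒴]

/-- Marginal `P(z)`. -/
def Pz (p : 𝒳 → 𝒵 → ℬ → ℛ → 𝒴 → ℝ) (z : 𝒵) : ℝ :=
  ∑ x, ∑ b, ∑ r, ∑ t, p x z b r t

/-- Marginal `P(x,z)`. -/
def Pxz (p : 𝒳 → 𝒵 → ℬ → ℛ → 𝒴 → ℝ) (x : 𝒳) (z : 𝒵) : ℝ :=
  ∑ b, ∑ r, ∑ t, p x z b r t

/-- Marginal `P(r,z)`. -/
def Prz (p : 𝒳 → 𝒵 → ℬ → ℛ → 𝒴 → ℝ) (r : ℛ) (z : 𝒵) : ℝ :=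
  ∑ x, ∑ b, ∑ t, p x z b r t

/-- Marginal `P(x,r,z)`. -/
def Pxrz (p : 𝒳 → 𝒵 → ℬ → ℛ → 𝒴 → ℝ) (x : 𝒳) (r : ℛ) (z : 𝒵) : ℝ :=
  ∑ b, ∑ t, p x z b r t

/-- Marginal `P(x,z,b,r)`. -/
def Pxzbr (p : 𝒳 → 𝒵 → ℬ → ℛ → 𝒴 → ℝ) (x : 𝒳) (z : 𝒵) (b : ℬ) (r : ℛ) : ℝ :=
  ∑ t, p x z b r t

/-- Conditional `P(x|z)`. -/
def PxGz (p : 𝒳 → 𝒵 → ℬ → ℛ → 𝒴 → ℝ) (x : 𝒳) (z : 𝒵) : ℝ := Pxz p x z / Pz p z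

/-- Conditional `P(r|x,z)`. -/
def PrGxz (p : 𝒳 → 𝒵 → ℬ → ℛ → 𝒴 → ℝ) (r : ℛ) (x : 𝒳) (z : 𝒵) : ℝ :=
  Pxrz p x r z / Pxz p x z

/-- Conditional `P(x|r,z)`. -/
def PxGrz (p : 𝒳 → 𝒵 → ℬ → ℛ → 𝒴 → ℝ) (x : 𝒳) (r : ℛ) (z : 𝒵) : ℝ :=
  Pxrz p x r z / Prz p r z

/-- Conditional `P(b|x,r,z)`. -/
def PbGxrz (p : 𝒳 → 𝒵 → ℬ → ℛ → 𝒴 → ℝ) (b : ℬ) (x : 𝒳) (r : ℛ) (z : 𝒵) : ℝ :=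
  Pxzbr p x z b r / Pxrz p x r z

/-- Conditional `P(ỹ|x,z,b,r)`. -/
def PyG (p : 𝒳 → 𝒵 → ℬ → ℛ → 𝒴 → ℝ) (t : 𝒴) (x : 𝒳) (z : 𝒵) (b : ℬ) (r : ℛ) : ℝ :=
  p x z b r t / Pxzbr p x z b r

/-- Outcome regression `m(x,b,r,z) = E[y(Ỹ) | X=x, Z=z, B=b, R=r]`. -/
def mReg (p : 𝒳 → 𝒵 → ℬ → ℛ → 𝒴 → ℝ) (y : 𝒴 → ℝ) (x : 𝒳) (b : ℬ) (r : ℛ) (z : 𝒵) : ℝ :=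
  ∑ t, y t * PyG p t x z b r

/-- the inverse-probability-weighted mean of the outcome equals
the identified path-specific functional `ψ`. -/
theorem ipw_outcome_identification
    [Nonempty 𝒳] [Nonempty 𝒵] [Nonempty ℬ] [Nonempty ℛ] [Nonempty 𝒴] [DecidableEq 𝒳]
    (p : 𝒳 → 𝒵 → ℬ → ℛ → 𝒴 → ℝ) (y : 𝒴 → ℝ)
    (hpos : ∀ x z b r t, 0 < p x z b r t)
    (hsum : ∑ x, ∑ z, ∑ b, ∑ r, ∑ t, p x z b r t = 1)
    (x₀ x₁ : 𝒳) :
    ∑ x, ∑ z, ∑ b, ∑ r, ∑ t,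
        ((PxGrz p x₀ r z / PxGrz p x r z)
            * ((if x = x₁ then (1 : ℝ) else 0) / PxGz p x₀ z))
          * y t * p x z b r t
      = ∑ b, ∑ r, ∑ z,
          mReg p y x₁ b r z * PbGxrz p b x₁ r z * PrGxz p r x₀ z * Pz p z := by
  have h1 : ∀ z, Pz p z ≠ 0 := fun z => ne_of_gt <| by
    unfold Pz
    exact sum_pos (fun x _ => sum_pos (fun b _ => sum_pos (fun r _ => sum_pos
      (fun t _ => hpos x z b r t) univ_nonempty) univ_nonempty) univ_nonempty) univ_nonempty
  have h2 : ∀ x z, Pxz p x z ≠ 0 := fun x z => ne_of_gt <| by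
    unfold Pxz
    exact sum_pos (fun b _ => sum_pos (fun r _ => sum_pos
      (fun t _ => hpos x z b r t) univ_nonempty) univ_nonempty) univ_nonempty
  have h3 : ∀ r z, Prz p r z ≠ 0 := fun r z => ne_of_gt <| by
    unfold Prz
    exact sum_pos (fun x _ => sum_pos (fun b _ => sum_pos
      (fun t _ => hpos x z b r t) univ_nonempty) univ_nonempty) univ_nonempty
  have h4 : ∀ x r z, Pxrz p x r z ≠ 0 := fun x r z => ne_of_gt <| by
    unfold Pxrz
    exact sum_pos (fun b _ => sum_pos
      (fun t _ => hpos x z b r t) univ_nonempty) univ_nonempty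
  have h5 : ∀ x z b r, Pxzbr p x z b r ≠ 0 := fun x z b r => ne_of_gt <| by
    unfold Pxzbr
    exact sum_pos (fun t _ => hpos x z b r t) univ_nonempty
  rw [Finset.sum_eq_single x₁]
  · rw [Finset.sum_comm]
    refine Finset.sum_congr rfl fun b _ => ?_
    rw [Finset.sum_comm]
    refine Finset.sum_congr rfl fun r _ => Finset.sum_congr rfl fun z _ => ?_
    unfold mReg
    rw [Finset.sum_mul, Finset.sum_mul, Finset.sum_mul]
    refine Finset.sum_congr rfl fun t _ => ?_
    unfold PyG PbGxrz PrGxz PxGrz PxGz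
    have a1 := h1 z
    have a2 := h2 x₀ z
    have a3 := h3 r z
    have a4 := h4 x₁ r z
    have a5 := h5 x₁ z b r
    rw [if_pos rfl]
    field_simp
  · intro x _ hx
    simp [hx]
  · intro h
    exact absurd (Finset.mem_univ x₁) h
end
end

section
/- Define the true nuisance functions μ³(b,r,x,z) = m(x,b,r,z), μ²(r,x,z) = Σ_b m(x₁,b,r,z) · P(b|x,r,z), μ¹(x,z) = Σ_r μ²(r,x₁,z) · P(r|x,z), π³(b,r,x,z) = π²(r,x,z) = (P(x₀|r,z)/P(x|r,z)) · (1[x = x₁]/P(x₀|z)), and π¹(x,z) = 1[x = x₀]/P(x|z). Define φ at a point v = (x,z,b,r,ỹ) by φ(v) = π³(b,r,x,z)·(y(ỹ) − μ³(b,r,x,z)) + π²(r,x,z)·(μ³(b,r,x₁,z) − μ²(r,x,z)) + π¹(x,z)·(μ²(r,x₁,z) − μ¹(x,z)) + μ¹(x₀,z). Then Σ_v φ(v) · p(v) = ψ, where ψ = Σ_{b,r,z} m(x₁,b,r,z) · P(b|x₁,r,z) · P(r|x₀,z) · P(z); that is, φ is a valid (uncentered influence-function) parametrization of the identified path-specific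 functional ψ. -/
open Finset

noncomputable section

variable {𝒳 𝒵 ℬ ℛ 𝒴 : Type*}
  [Fintype 𝒳] [Fintype 𝒵] [Fintype ℬ] [Fintype ℛ] [Fintype 𝒴]

lemma resid_zero {ι : Type*} [Fintype ι] (f w : ι → ℝ) (W : ℝ) (hW : ∑ i, w i = W)
    (h0 : W ≠ 0) : ∑ i, (f i - ∑ j, f j * (w j / W)) * w i = 0 := by
  have h1 : ∑ j, f j * (w j / W) = (∑ j, f j * w j) / W := by
    rw [Finset.sum_div]
    exact Finset.sum_congr rfl fun j _ => by ring
  simp only [sub_mul, Finset.sum_sub_distrib, ← Finset.mul_sum, hW, h1]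
  field_simp
  ring

/-- Abstract version of the computation with generic weights. -/
lemma phi_sum (p : 𝒳 → 𝒵 → ℬ → ℛ → 𝒴 → ℝ) (c : 𝒳 → 𝒵 → ℛ → ℝ) (e : 𝒳 → 𝒵 → ℝ)
    (A : 𝒳 → 𝒵 → ℬ → ℛ → 𝒴 → ℝ) (B : 𝒳 → 𝒵 → ℬ → ℛ → ℝ) (C : 𝒳 → 𝒵 → ℛ → ℝ) (H : 𝒵 → ℝ)
    (hA : ∀ x z b r, ∑ t, A x z b r t * p x z b r t = 0)
    (hB : ∀ x z r, c x z r * ∑ b, B x z b r * Pxzbr p x z b r = 0)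
    (hC : ∀ x z, ∑ r, C x z r * Pxrz p x r z = 0) :
    ∑ x, ∑ z, ∑ b, ∑ r, ∑ t,
      (c x z r * A x z b r t + c x z r * B x z b r + e x z * C x z r + H z) * p x z b r t
      = ∑ z, H z * Pz p z := by
  have key : ∀ x z, ∑ b, ∑ r, ∑ t,
      (c x z r * A x z b r t + c x z r * B x z b r + e x z * C x z r + H z) * p x z b r t
      = H z * Pxz p x z := by
    intro x z
    have h1 : ∀ b r, ∑ t,
        (c x z r * A x z b r t + c x z r * B x z b r + e x z * C x z r + H z) * p x z b r t
        = c x z r * (B x z b r * Pxzbr p x z b r) + e x z * (C x z r * Pxzbr p x z b r)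
          + H z * Pxzbr p x z b r := by
      intro b r
      have := hA x z b r
      simp only [add_mul, Finset.sum_add_distrib, mul_assoc, ← Finset.mul_sum, this, Pxzbr]
      ring
    simp only [h1, Finset.sum_add_distrib]
    have h2 : ∑ b, ∑ r, c x z r * (B x z b r * Pxzbr p x z b r) = 0 := by
      rw [Finset.sum_comm]
      simp only [← Finset.mul_sum, hB, Finset.sum_const_zero]
    have h3 : ∑ b, ∑ r, e x z * (C x z r * Pxzbr p x z b r) = 0 := by
      rw [Finset.sum_comm]
      simp only [← Finset.mul_sum]
      have := hC x z
      simp only [Pxrz] at this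
      simp only [Pxzbr, this, mul_zero]
    rw [h2, h3]
    simp only [← Finset.mul_sum, Pxz, Pxzbr]
    ring
  simp only [key]
  rw [Finset.sum_comm]
  simp only [← Finset.mul_sum, Pz, Pxz]

/-- `φ` built from the true nuisance functions is a valid
(uncentered influence-function) parametrization of `ψ`. -/
theorem phi_parametrization
    [Nonempty 𝒳] [Nonempty 𝒵] [Nonempty ℬ] [Nonempty ℛ] [Nonempty 𝒴] [DecidableEq 𝒳]
    (p : 𝒳 → 𝒵 → ℬ → ℛ → 𝒴 → ℝ) (y : 𝒴 → ℝ)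
    (hpos : ∀ x z b r t, 0 < p x z b r t)
    (hsum : ∑ x, ∑ z, ∑ b, ∑ r, ∑ t, p x z b r t = 1)
    (x₀ x₁ : 𝒳) :
    ∑ x, ∑ z, ∑ b, ∑ r, ∑ t,
        (((PxGrz p x₀ r z / PxGrz p x r z)
              * ((if x = x₁ then (1 : ℝ) else 0) / PxGz p x₀ z))
            * (y t - mReg p y x b r z)
          + ((PxGrz p x₀ r z / PxGrz p x r z)
              * ((if x = x₁ then (1 : ℝ) else 0) / PxGz p x₀ z))
            * (mReg p y x₁ b r z
                - ∑ b', mReg p y x₁ b' r z * PbGxrz p b' x r z)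
          + ((if x = x₀ then (1 : ℝ) else 0) / PxGz p x z)
            * ((∑ b', mReg p y x₁ b' r z * PbGxrz p b' x₁ r z)
                - ∑ r', (∑ b', mReg p y x₁ b' r' z * PbGxrz p b' x₁ r' z)
                    * PrGxz p r' x z)
          + ∑ r', (∑ b', mReg p y x₁ b' r' z * PbGxrz p b' x₁ r' z)
              * PrGxz p r' x₀ z)
          * p x z b r t
      = ∑ b, ∑ r, ∑ z,
          mReg p y x₁ b r z * PbGxrz p b x₁ r z * PrGxz p r x₀ z * Pz p z := by
  have pxzbr : ∀ x z b r, Pxzbr p x z b r ≠ 0 := fun x z b r =>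
    (Finset.sum_pos (fun t _ => hpos x z b r t) Finset.univ_nonempty).ne'
  have pxrz : ∀ x r z, Pxrz p x r z ≠ 0 := fun x r z =>
    (Finset.sum_pos (fun b _ => Finset.sum_pos (fun t _ => hpos x z b r t)
      Finset.univ_nonempty) Finset.univ_nonempty).ne'
  have pxz : ∀ x z, Pxz p x z ≠ 0 := fun x z =>
    (Finset.sum_pos (fun b _ => Finset.sum_pos (fun r _ => Finset.sum_pos
      (fun t _ => hpos x z b r t) Finset.univ_nonempty)
      Finset.univ_nonempty) Finset.univ_nonempty).ne'
  have := phi_sum p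
    (fun x z r => (PxGrz p x₀ r z / PxGrz p x r z)
              * ((if x = x₁ then (1 : ℝ) else 0) / PxGz p x₀ z))
    (fun x z => (if x = x₀ then (1 : ℝ) else 0) / PxGz p x z)
    (fun x z b r t => y t - mReg p y x b r z)
    (fun x z b r => mReg p y x₁ b r z - ∑ b', mReg p y x₁ b' r z * PbGxrz p b' x r z)
    (fun x z r => (∑ b', mReg p y x₁ b' r z * PbGxrz p b' x₁ r z)
                - ∑ r', (∑ b', mReg p y x₁ b' r' z * PbGxrz p b' x₁ r' z)
                    * PrGxz p r' x z)
    (fun z => ∑ r', (∑ b', mReg p y x₁ b' r' z * PbGxrz p b' x₁ r' z)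
              * PrGxz p r' x₀ z)
    (fun x z b r => resid_zero y (fun t => p x z b r t) _ rfl (pxzbr x z b r))
    (fun x z r => mul_eq_zero_of_right _ (resid_zero (fun b => mReg p y x₁ b r z)
      (fun b => Pxzbr p x z b r) _ rfl (pxrz x r z)))
    (fun x z => resid_zero (fun r => ∑ b', mReg p y x₁ b' r z * PbGxrz p b' x₁ r z)
      (fun r => Pxrz p x r z) (Pxz p x z) Finset.sum_comm (pxz x z))
  refine this.trans ?_
  simp only [Finset.sum_mul]
  rw [Finset.sum_comm]
  rw [Finset.sum_comm (s := (Finset.univ : Finset ℬ))]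
  refine Finset.sum_congr rfl fun r _ => ?_
  rw [Finset.sum_comm]
end
end

section
/- Let μ̂³ : ℬ × ℛ × 𝒳 × 𝒵 → ℝ, μ̂² : ℛ × 𝒳 × 𝒵 → ℝ, μ̂¹ : 𝒳 × 𝒵 → ℝ be arbitrary functions, and let the weights be the true ones: π³(b,r,x,z) = π²(r,x,z) = (P(x₀|r,z)/P(x|r,z)) · (1[x = x₁]/P(x₀|z)) and π¹(x,z) = 1[x = x₀]/P(x|z). Define φ at v = (x,z,b,r,ỹ) by φ(v) = π³(b,r,x,z)·(y(ỹ) − μ̂³(b,r,x,z)) + π²(r,x,z)·(μ̂³(b,r,x₁,z) − μ̂²(r,x,z)) + π¹(x,z)·(μ̂²(r,x₁,z) − μ̂¹(x,z)) + μ̂¹(x₀,z). Then Σ_v φ(v) · p(v) = ψ, where ψ = Σ_{b,r,z} m(x₁,b,r,z) · P(b|x₁,r,z) · P(r|x₀,z) · P(z); that is, the estimator is robust to arbitrary misspecification of all three outcome-regression nuisances when the weights are correctly specified. -/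
open Finset

noncomputable section

variable {𝒳 𝒵 ℬ ℛ 𝒴 : Type*}
  [Fintype 𝒳] [Fintype 𝒵] [Fintype ℬ] [Fintype ℛ] [Fintype 𝒴]

/-- robustness to arbitrary misspecification of all three
outcome-regression nuisances when the weights are correctly specified. -/
theorem robust_to_outcome_misspecification
    [Nonempty 𝒳] [Nonempty 𝒵] [Nonempty ℬ] [Nonempty ℛ] [Nonempty 𝒴] [DecidableEq 𝒳]
    (p : 𝒳 → 𝒵 → ℬ → ℛ → 𝒴 → ℝ) (y : 𝒴 → ℝ)
    (hpos : ∀ x z b r t, 0 < p x z b r t)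
    (hsum : ∑ x, ∑ z, ∑ b, ∑ r, ∑ t, p x z b r t = 1)
    (x₀ x₁ : 𝒳)
    (μhat3 : ℬ × ℛ × 𝒳 × 𝒵 → ℝ) (μhat2 : ℛ × 𝒳 × 𝒵 → ℝ) (μhat1 : 𝒳 × 𝒵 → ℝ) :
    ∑ x, ∑ z, ∑ b, ∑ r, ∑ t,
        (((PxGrz p x₀ r z / PxGrz p x r z)
              * ((if x = x₁ then (1 : ℝ) else 0) / PxGz p x₀ z))
            * (y t - μhat3 (b, r, x, z))
          + ((PxGrz p x₀ r z / PxGrz p x r z)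
              * ((if x = x₁ then (1 : ℝ) else 0) / PxGz p x₀ z))
            * (μhat3 (b, r, x₁, z) - μhat2 (r, x, z))
          + ((if x = x₀ then (1 : ℝ) else 0) / PxGz p x z)
            * (μhat2 (r, x₁, z) - μhat1 (x, z))
          + μhat1 (x₀, z))
          * p x z b r t
      = ∑ b, ∑ r, ∑ z,
          mReg p y x₁ b r z * PbGxrz p b x₁ r z * PrGxz p r x₀ z * Pz p z := by
  have h1 : ∀ x z r, 0 < Pxrz p x r z := fun x z r =>
    Finset.sum_pos (fun b _ => Finset.sum_pos (fun t _ => hpos x z b r t) univ_nonempty)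
      univ_nonempty
  have h2 : ∀ x z, 0 < Pxz p x z := fun x z =>
    Finset.sum_pos (fun b _ => Finset.sum_pos (fun r _ => Finset.sum_pos
      (fun t _ => hpos x z b r t) univ_nonempty) univ_nonempty) univ_nonempty
  have h3 : ∀ z, 0 < Pz p z := fun z => Finset.sum_pos (fun x _ => h2 x z) univ_nonempty
  have h4 : ∀ r z, 0 < Prz p r z := fun r z =>
    Finset.sum_pos (fun x _ => h1 x z r) univ_nonempty
  have h5 : ∀ x z b r, 0 < Pxzbr p x z b r := fun x z b r =>
    Finset.sum_pos (fun t _ => hpos x z b r t) univ_nonempty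
  have hm : ∀ x z, ∑ r, Pxrz p x r z = Pxz p x z := fun x z => by
    unfold Pxrz Pxz; exact Finset.sum_comm
  -- right-hand side, regrouped
  have hR : ∑ b, ∑ r, ∑ z, mReg p y x₁ b r z * PbGxrz p b x₁ r z * PrGxz p r x₀ z * Pz p z
      = ∑ z, ∑ r, ∑ b, ∑ t,
        (Pxrz p x₀ r z / Pxrz p x₁ r z * (Pz p z / Pxz p x₀ z)) * (y t * p x₁ z b r t) := by
    rw [Finset.sum_comm]
    simp_rw [fun r => Finset.sum_comm (s := (univ : Finset ℬ)) (t := (univ : Finset 𝒵))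
      (f := fun b z => mReg p y x₁ b r z * PbGxrz p b x₁ r z * PrGxz p r x₀ z * Pz p z)]
    rw [Finset.sum_comm]
    refine Finset.sum_congr rfl fun z _ => Finset.sum_congr rfl fun r _ =>
      Finset.sum_congr rfl fun b _ => ?_
    simp only [mReg, PyG, PbGxrz, PrGxz, Finset.sum_mul]
    refine Finset.sum_congr rfl fun t _ => ?_
    have := (h1 x₁ z r).ne'
    have := (h2 x₀ z).ne'
    have := (h5 x₁ z b r).ne'
    field_simp
  rw [hR, Finset.sum_comm]
  refine Finset.sum_congr rfl fun z _ => ?_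
  -- pointwise rewriting of the summand
  have hpt : ∀ x b r t,
      (((PxGrz p x₀ r z / PxGrz p x r z)
              * ((if x = x₁ then (1 : ℝ) else 0) / PxGz p x₀ z))
            * (y t - μhat3 (b, r, x, z))
          + ((PxGrz p x₀ r z / PxGrz p x r z)
              * ((if x = x₁ then (1 : ℝ) else 0) / PxGz p x₀ z))
            * (μhat3 (b, r, x₁, z) - μhat2 (r, x, z))
          + ((if x = x₀ then (1 : ℝ) else 0) / PxGz p x z)
            * (μhat2 (r, x₁, z) - μhat1 (x, z))
          + μhat1 (x₀, z))
          * p x z b r t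
      = (if x = x₁ then (Pxrz p x₀ r z / Pxrz p x₁ r z * (Pz p z / Pxz p x₀ z))
            * (y t * p x₁ z b r t)
          - (Pxrz p x₀ r z / Pxrz p x₁ r z * (Pz p z / Pxz p x₀ z)) * μhat2 (r, x₁, z)
            * p x₁ z b r t else 0)
        + (if x = x₀ then (Pz p z / Pxz p x₀ z) * (μhat2 (r, x₁, z) - μhat1 (x₀, z))
            * p x₀ z b r t else 0)
        + μhat1 (x₀, z) * p x z b r t := by
    intro x b r t
    have e1 : ∀ x, PxGrz p x₀ r z / PxGrz p x r z = Pxrz p x₀ r z / Pxrz p x r z := fun x => by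
      have := (h4 r z).ne'
      have := (h1 x z r).ne'
      unfold PxGrz
      field_simp
    have e2 : ∀ x, ∀ a : ℝ, a / PxGz p x z = a * (Pz p z / Pxz p x z) := fun x a => by
      unfold PxGz
      rw [div_div_eq_mul_div, mul_div_assoc]
    rw [e1, e2, e2]
    by_cases hx1 : x = x₁
    · by_cases hx0 : x = x₀
      · subst hx1; subst hx0; simp only [if_true]; ring
      · subst hx1; simp only [if_true, if_neg hx0]; ring
    · by_cases hx0 : x = x₀
      · subst hx0; simp only [if_true, if_neg hx1]; ring
      · simp only [if_neg hx0, if_neg hx1]; ring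
  simp_rw [hpt]
  have hsw : ∀ f : ℬ → ℛ → ℝ, ∑ b, ∑ r, f b r = ∑ r, ∑ b, f b r := fun f => Finset.sum_comm
  simp_rw [hsw]
  -- collapse the sum over `x` and split
  have hx : ∀ F G : ℛ → ℬ → 𝒴 → ℝ, ∀ H : 𝒳 → ℛ → ℬ → 𝒴 → ℝ,
      ∑ x, ∑ r, ∑ b, ∑ t, ((if x = x₁ then F r b t else 0) + (if x = x₀ then G r b t else 0)
        + H x r b t)
      = ∑ r, ∑ b, ∑ t, F r b t + ∑ r, ∑ b, ∑ t, G r b t + ∑ x, ∑ r, ∑ b, ∑ t, H x r b t := by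
    intro F G H
    simp only [Finset.sum_add_distrib]
    congr 2
    · rw [Finset.sum_eq_single x₁ (fun x _ h => by simp [h]) (by simp)]; simp
    · rw [Finset.sum_eq_single x₀ (fun x _ h => by simp [h]) (by simp)]; simp
  rw [hx]
  simp only [Finset.sum_sub_distrib]
  have hA : ∑ r, ∑ b, ∑ t, (Pxrz p x₀ r z / Pxrz p x₁ r z * (Pz p z / Pxz p x₀ z))
      * μhat2 (r, x₁, z) * p x₁ z b r t
      = ∑ r, (Pz p z / Pxz p x₀ z) * μhat2 (r, x₁, z) * Pxrz p x₀ r z := by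
    refine Finset.sum_congr rfl fun r _ => ?_
    simp only [← Finset.mul_sum]
    change _ * Pxrz p x₁ r z = _
    have := (h1 x₁ z r).ne'
    have := (h2 x₀ z).ne'
    field_simp
  have hB : ∑ r, ∑ b, ∑ t, (Pz p z / Pxz p x₀ z) * (μhat2 (r, x₁, z) - μhat1 (x₀, z))
      * p x₀ z b r t
      = ∑ r, (Pz p z / Pxz p x₀ z) * μhat2 (r, x₁, z) * Pxrz p x₀ r z
        - μhat1 (x₀, z) * Pz p z := by
    have : μhat1 (x₀, z) * Pz p z
        = ∑ r, (Pz p z / Pxz p x₀ z) * μhat1 (x₀, z) * Pxrz p x₀ r z := by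
      rw [← Finset.mul_sum, hm]
      have := (h2 x₀ z).ne'
      field_simp
    rw [this, ← Finset.sum_sub_distrib]
    refine Finset.sum_congr rfl fun r _ => ?_
    simp only [← Finset.mul_sum]
    change _ * Pxrz p x₀ r z = _
    ring
  have hC : ∑ x, ∑ r, ∑ b, ∑ t, μhat1 (x₀, z) * p x z b r t = μhat1 (x₀, z) * Pz p z := by
    simp only [← Finset.mul_sum]
    congr 1
    exact Finset.sum_congr rfl fun x _ => hm x z
  rw [hA, hB, hC]
  ring
end
end

section
/- Let π̂³ : ℬ × ℛ × 𝒳 × 𝒵 → ℝ, π̂² : ℛ × 𝒳 × 𝒵 → ℝ, π̂¹ : 𝒳 × 𝒵 → ℝ be arbitrary functions, and let the outcome regressions be the true ones: μ³(b,r,x,z) = m(x,b,r,z), μ²(r,x,z) = Σ_b m(x₁,b,r,z) · P(b|x,r,z), μ¹(x,z) = Σ_r μ²(r,x₁,z) · P(r|x,z). Define φ at v = (x,z,b,r,ỹ) by φ(v) = π̂³(b,r,x,z)·(y(ỹ) − μ³(b,r,x,z)) + π̂²(r,x,z)·(μ³(b,r,x₁,z) − μ²(r,x,z)) + π̂¹(x,z)·(μ²(r,x₁,z)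 − μ¹(x,z)) + μ¹(x₀,z). Then Σ_v φ(v) · p(v) = ψ, where ψ = Σ_{b,r,z} m(x₁,b,r,z) · P(b|x₁,r,z) · P(r|x₀,z) · P(z); that is, the estimator is robust to arbitrary misspecification of all three weight nuisances when the outcome regressions are correctly specified. -/
open Finset

noncomputable section

variable {𝒳 𝒵 ℬ ℛ 𝒴 : Type*}
  [Fintype 𝒳] [Fintype 𝒵] [Fintype ℬ] [Fintype ℛ] [Fintype 𝒴]

theorem aux_center {ι : Type*} [Fintype ι] (f w : ι → ℝ) (W : ℝ) (hW : W = ∑ i, w i)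
    (h : W ≠ 0) : ∑ i, (f i - ∑ j, f j * (w j / W)) * w i = 0 := by
  have h1 : ∑ j, f j * (w j / W) = (∑ j, f j * w j) / W := by
    rw [Finset.sum_div]
    exact Finset.sum_congr rfl fun j _ => by ring
  rw [h1]
  simp only [sub_mul, Finset.sum_sub_distrib]
  rw [← Finset.mul_sum, ← hW, div_mul_cancel₀ _ h, sub_self]

/-- robustness to arbitrary misspecification of all three weight
nuisances when the outcome regressions are correctly specified. -/
theorem robust_to_weight_misspecification
    [Nonempty 𝒳] [Nonempty 𝒵] [Nonempty ℬ] [Nonempty ℛ] [Nonempty 𝒴] [DecidableEq 𝒳]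
    (p : 𝒳 → 𝒵 → ℬ → ℛ → 𝒴 → ℝ) (y : 𝒴 → ℝ)
    (hpos : ∀ x z b r t, 0 < p x z b r t)
    (hsum : ∑ x, ∑ z, ∑ b, ∑ r, ∑ t, p x z b r t = 1)
    (x₀ x₁ : 𝒳)
    (πhat3 : ℬ × ℛ × 𝒳 × 𝒵 → ℝ) (πhat2 : ℛ × 𝒳 × 𝒵 → ℝ) (πhat1 : 𝒳 × 𝒵 → ℝ) :
    ∑ x, ∑ z, ∑ b, ∑ r, ∑ t,
        (πhat3 (b, r, x, z) * (y t - mReg p y x b r z)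
          + πhat2 (r, x, z)
            * (mReg p y x₁ b r z
                - ∑ b', mReg p y x₁ b' r z * PbGxrz p b' x r z)
          + πhat1 (x, z)
            * ((∑ b', mReg p y x₁ b' r z * PbGxrz p b' x₁ r z)
                - ∑ r', (∑ b', mReg p y x₁ b' r' z * PbGxrz p b' x₁ r' z)
                    * PrGxz p r' x z)
          + ∑ r', (∑ b', mReg p y x₁ b' r' z * PbGxrz p b' x₁ r' z)
              * PrGxz p r' x₀ z)
          * p x z b r t
      = ∑ b, ∑ r, ∑ z,
          mReg p y x₁ b r z * PbGxrz p b x₁ r z * PrGxz p r x₀ z * Pz p z := by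
  have hA : ∀ x z b r, Pxzbr p x z b r ≠ 0 := fun x z b r =>
    (Finset.sum_pos (fun t _ => hpos x z b r t) Finset.univ_nonempty).ne'
  have hB : ∀ x r z, Pxrz p x r z ≠ 0 := fun x r z =>
    (Finset.sum_pos (fun b _ => Finset.sum_pos (fun t _ => hpos x z b r t)
      Finset.univ_nonempty) Finset.univ_nonempty).ne'
  have hC : ∀ x z, Pxz p x z ≠ 0 := fun x z =>
    (Finset.sum_pos (fun b _ => Finset.sum_pos (fun r _ => Finset.sum_pos
      (fun t _ => hpos x z b r t) Finset.univ_nonempty) Finset.univ_nonempty)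
      Finset.univ_nonempty).ne'
  have hCr : ∀ x z, Pxz p x z = ∑ r, Pxrz p x r z := fun x z => Finset.sum_comm
  have h3 : ∀ x z b r, ∑ t, (y t - mReg p y x b r z) * p x z b r t = 0 := fun x z b r =>
    aux_center y (fun t => p x z b r t) (Pxzbr p x z b r) rfl (hA x z b r)
  have h2 : ∀ (f : ℬ → ℝ) x r z,
      ∑ b, (f b - ∑ b', f b' * PbGxrz p b' x r z) * Pxzbr p x z b r = 0 := fun f x r z =>
    aux_center f (fun b => Pxzbr p x z b r) (Pxrz p x r z) rfl (hB x r z)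
  have h1 : ∀ (g : ℛ → ℝ) x z,
      ∑ r, (g r - ∑ r', g r' * PrGxz p r' x z) * Pxrz p x r z = 0 := fun g x z =>
    aux_center g (fun r => Pxrz p x r z) (Pxz p x z) (hCr x z) (hC x z)
  -- the general telescoping identity at fixed `(x, z)`
  have key : ∀ (x : 𝒳) (z : 𝒵) (a c : ℝ) (w3 : ℬ → ℛ → ℝ) (w2 : ℛ → ℝ) (f : ℬ → ℛ → ℝ)
      (g : ℛ → ℝ),
      ∑ b, ∑ r, ∑ t, (w3 b r * (y t - mReg p y x b r z)
        + w2 r * (f b r - ∑ b', f b' r * PbGxrz p b' x r z)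
        + a * (g r - ∑ r', g r' * PrGxz p r' x z) + c) * p x z b r t = c * Pxz p x z := by
    intro x z a c w3 w2 f g
    have e1 : ∀ b r, ∑ t, (w3 b r * (y t - mReg p y x b r z)
        + w2 r * (f b r - ∑ b', f b' r * PbGxrz p b' x r z)
        + a * (g r - ∑ r', g r' * PrGxz p r' x z) + c) * p x z b r t
        = w2 r * ((f b r - ∑ b', f b' r * PbGxrz p b' x r z) * Pxzbr p x z b r)
          + (a * (g r - ∑ r', g r' * PrGxz p r' x z) + c) * Pxzbr p x z b r := by
      intro b r
      have h := h3 x z b r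
      simp only [add_mul, mul_assoc, Finset.sum_add_distrib, ← Finset.mul_sum, h]
      simp only [Pxzbr]
      ring
    have e2 : ∀ r, ∑ b, (w2 r * ((f b r - ∑ b', f b' r * PbGxrz p b' x r z) * Pxzbr p x z b r)
          + (a * (g r - ∑ r', g r' * PrGxz p r' x z) + c) * Pxzbr p x z b r)
        = a * ((g r - ∑ r', g r' * PrGxz p r' x z) * Pxrz p x r z) + c * Pxrz p x r z := by
      intro r
      have h := h2 (fun b => f b r) x r z
      rw [Finset.sum_add_distrib, ← Finset.mul_sum, ← Finset.mul_sum, h]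
      simp only [Pxrz, Pxzbr]
      ring
    simp only [e1]
    rw [Finset.sum_comm]
    simp only [e2]
    rw [Finset.sum_add_distrib, ← Finset.mul_sum, ← Finset.mul_sum, h1 g x z, ← hCr]
    ring
  have step := fun x z => key x z (πhat1 (x, z))
    (∑ r', (∑ b', mReg p y x₁ b' r' z * PbGxrz p b' x₁ r' z) * PrGxz p r' x₀ z)
    (fun b r => πhat3 (b, r, x, z)) (fun r => πhat2 (r, x, z))
    (fun b r => mReg p y x₁ b r z) (fun r => ∑ b', mReg p y x₁ b' r z * PbGxrz p b' x₁ r z)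
  rw [Finset.sum_congr rfl fun x _ => Finset.sum_congr rfl fun z _ => step x z]
  have hz : ∀ z, Pz p z = ∑ x, Pxz p x z := fun z => rfl
  rw [Finset.sum_comm]
  simp only [← Finset.mul_sum, ← hz]
  rw [Finset.sum_comm]
  rw [Finset.sum_congr rfl fun r _ => Finset.sum_comm]
  rw [Finset.sum_comm]
  simp only [Finset.sum_mul]
end
end
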